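/- (General lower bound on JSCC distortion) In the single-letter JSCC setup, suppose A ⊆ S, d_max > 0, γ ∈ ℝ, k ∈ ℝ, and R : [0,∞) → ℝ is antitone (nonincreasing); suppose d(s, g(y)) ≤ d_max for all s ∈ S and y ∈ Y, and for every α ∈ [0, d_max] and every ŝ ∈ Ŝ, P(S ∈ A and d(S, ŝ) ≤ α) ≤ 2^{−n(R(α) + k)}. Then E[d(S, g(Y))] ≥ ∫₀^{d_max} P(i(S,Y) ≤ R(α) − γ) dα − d_max·2^{−n(γ + k)} − d_max·P(S ∉ A). -/

import Mathlib

open scoped BigOperators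

/-- Probability of an event under a PMF on a finite type. -/
noncomputable def srcPr {S : Type*} [Fintype S] (p : PMF S) (E : Set S) : ℝ :=
  ∑ s, E.indicator (fun s => (p s).toReal) s

/-- Probability of an event for the joint law `P(s, y) = p(s) · W(e(s))(y)`
of the source and the channel output. -/
noncomputable def jointPr {S X Y : Type*} [Fintype S] [Fintype Y]
    (p : PMF S) (W : X → PMF Y) (e : S → X) (E : Set (S × Y)) : ℝ :=
  ∑ s, ∑ y, E.indicator (fun sy => (p sy.1 * W (e sy.1) sy.2).toReal) (s, y)

/-- The output marginal `q(y) = ∑ s, p(s) · W(e(s))(y)`. -/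
noncomputable def outQ {S X Y : Type*} [Fintype S]
    (p : PMF S) (W : X → PMF Y) (e : S → X) (y : Y) : ℝ :=
  ∑ s, (p s * W (e s) y).toReal

/-- The normalized information density `i(s; y) = (1/n) log₂ (W(e(s))(y) / q(y))`. -/
noncomputable def infoDensity {S X Y : Type*} [Fintype S]
    (n : ℕ) (p : PMF S) (W : X → PMF Y) (e : S → X) (s : S) (y : Y) : ℝ :=
  (1 / (n : ℝ)) * Real.logb 2 ((W (e s) y).toReal / outQ p W e y)

/-- Expectation of the distortion `d(S, g(Y))` under the joint law
`P(s, y) = p(s) · W(e(s))(y)`. -/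
noncomputable def jointExp {S X Y Sh : Type*} [Fintype S] [Fintype Y]
    (p : PMF S) (W : X → PMF Y) (e : S → X) (g : Y → Sh) (d : S → Sh → ℝ) : ℝ :=
  ∑ s, ∑ y, (p s * W (e s) y).toReal * d s (g y)

lemma PMF.sum_toReal_eq_one {T : Type*} [Fintype T] (p : PMF T) : ∑ t, (p t).toReal = 1 := by
  rw [← ENNReal.toReal_sum fun t _ => p.apply_ne_top t, ← tsum_fintype (L := .unconditional T),
    p.tsum_coe, ENNReal.toReal_one]

lemma sum_outQ {S X Y : Type*} [Fintype S] [Fintype Y]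
    (p : PMF S) (W : X → PMF Y) (e : S → X) : ∑ y, outQ p W e y = 1 := by
  simp only [outQ, ENNReal.toReal_mul]
  rw [Finset.sum_comm]
  simp only [← Finset.mul_sum, PMF.sum_toReal_eq_one, mul_one]

lemma outQ_nonneg {S X Y : Type*} [Fintype S]
    (p : PMF S) (W : X → PMF Y) (e : S → X) (y : Y) : 0 ≤ outQ p W e y :=
  Finset.sum_nonneg fun _ _ => ENNReal.toReal_nonneg

lemma joint_le_outQ {S X Y : Type*} [Fintype S]
    (p : PMF S) (W : X → PMF Y) (e : S → X) (s : S) (y : Y) :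
    (p s * W (e s) y).toReal ≤ outQ p W e y :=
  Finset.single_le_sum (f := fun s => (p s * W (e s) y).toReal)
    (fun _ _ => ENNReal.toReal_nonneg) (Finset.mem_univ s)

/-- Change of measure: where the information density is at most `t`, the joint law is dominated by
`2 ^ (n * t)` times the product of its marginals. -/
lemma joint_le_of_infoDensity_le {S X Y : Type*} [Fintype S] {n : ℕ} (hn : 1 ≤ n)
    (p : PMF S) (W : X → PMF Y) (e : S → X) {s : S} {y : Y} {t : ℝ}
    (h : infoDensity n p W e s y ≤ t) :
    (p s * W (e s) y).toReal ≤ (p s).toReal * (outQ p W e y * 2 ^ ((n : ℝ) * t)) := by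
  have hr : 0 ≤ (p s).toReal * (outQ p W e y * 2 ^ ((n : ℝ) * t)) :=
    mul_nonneg ENNReal.toReal_nonneg (mul_nonneg (outQ_nonneg p W e y) (by positivity))
  rcases (ENNReal.toReal_nonneg (a := p s * W (e s) y)).eq_or_lt with h0 | h0
  · rwa [← h0]
  have hq := h0.trans_le (joint_le_outQ p W e s y)
  rw [ENNReal.toReal_mul] at h0 ⊢
  have hW : 0 < (W (e s) y).toReal := pos_of_mul_pos_right h0 ENNReal.toReal_nonneg
  have hn' : (0 : ℝ) < n := by exact_mod_cast hn
  refine mul_le_mul_of_nonneg_left ?_ ENNReal.toReal_nonneg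
  rw [infoDensity, one_div, inv_mul_le_iff₀ hn',
    Real.logb_le_iff_le_rpow one_lt_two (div_pos hW hq), div_le_iff₀ hq] at h
  rwa [mul_comm]

lemma jointPr_mono {S X Y : Type*} [Fintype S] [Fintype Y]
    (p : PMF S) (W : X → PMF Y) (e : S → X) {E F : Set (S × Y)} (h : E ⊆ F) :
    jointPr p W e E ≤ jointPr p W e F :=
  Finset.sum_le_sum fun _ _ => Finset.sum_le_sum fun _ _ =>
    Set.indicator_le_indicator_of_subset h (fun _ => ENNReal.toReal_nonneg) _

lemma jointPr_union_le {S X Y : Type*} [Fintype S] [Fintype Y]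
    (p : PMF S) (W : X → PMF Y) (e : S → X) (E F : Set (S × Y)) :
    jointPr p W e (E ∪ F) ≤ jointPr p W e E + jointPr p W e F := by
  simp only [jointPr, ← Finset.sum_add_distrib]
  refine Finset.sum_le_sum fun s _ => Finset.sum_le_sum fun y _ => ?_
  have h : 0 ≤ (p s * W (e s) y).toReal := ENNReal.toReal_nonneg
  by_cases hE : (s, y) ∈ E <;> by_cases hF : (s, y) ∈ F <;> simp [hE, hF, -ENNReal.toReal_mul, h]

lemma jointPr_fst {S X Y : Type*} [Fintype S] [Fintype Y]
    (p : PMF S) (W : X → PMF Y) (e : S → X) (B : Set S) :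
    jointPr p W e {sy | sy.1 ∈ B} = srcPr p B := by
  refine Finset.sum_congr rfl fun s _ => ?_
  by_cases hs : s ∈ B
  · simp [hs, ← Finset.mul_sum, PMF.sum_toReal_eq_one]
  · simp [hs]

/-- If every section of `B` has source probability at most `c`, then the event that `B` occurs
while the information density is at most `t` has probability at most `2 ^ (n * t) * c`. -/
lemma jointPr_infoDensity_le_inter {S X Y : Type*} [Fintype S] [Fintype Y]
    {n : ℕ} (hn : 1 ≤ n) (p : PMF S) (W : X → PMF Y) (e : S → X) (B : Y → Set S) {t c : ℝ}
    (hB : ∀ y, srcPr p (B y) ≤ c) :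
    jointPr p W e ({sy | infoDensity n p W e sy.1 sy.2 ≤ t} ∩ {sy | sy.1 ∈ B sy.2}) ≤
      2 ^ ((n : ℝ) * t) * c := by
  calc
    _ ≤ ∑ s, ∑ y, outQ p W e y * 2 ^ ((n : ℝ) * t) *
          (B y).indicator (fun s => (p s).toReal) s := by
        refine Finset.sum_le_sum fun s _ => Finset.sum_le_sum fun y _ => ?_
        refine Set.indicator_apply_le' (fun h => ?_) (fun _ => ?_)
        · have hs : s ∈ B y := h.2
          rw [Set.indicator_of_mem hs, mul_comm _ (p s).toReal]
          exact joint_le_of_infoDensity_le hn p W e h.1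
        · exact mul_nonneg (mul_nonneg (outQ_nonneg p W e y) (by positivity))
            (Set.indicator_nonneg (fun _ _ => ENNReal.toReal_nonneg) _)
    _ = ∑ y, outQ p W e y * 2 ^ ((n : ℝ) * t) * srcPr p (B y) := by
        rw [Finset.sum_comm]
        simp only [srcPr, Finset.mul_sum]
    _ ≤ ∑ y, outQ p W e y * 2 ^ ((n : ℝ) * t) * c := by
        refine Finset.sum_le_sum fun y _ => mul_le_mul_of_nonneg_left (hB y) ?_
        exact mul_nonneg (outQ_nonneg p W e y) (by positivity)
    _ = _ := by
        rw [← Finset.sum_mul, ← Finset.sum_mul, sum_outQ, one_mul]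

lemma integral_indicator_Iio_const {x b : ℝ} (c : ℝ) (hx : 0 ≤ x) (hxb : x ≤ b) :
    ∫ α in (0 : ℝ)..b, (Set.Iio x).indicator (fun _ => c) α = c * x := by
  have h : Set.Ioc 0 b ∩ Set.Iio x = Set.Ioo 0 x := by
    ext α
    simp only [Set.mem_inter_iff, Set.mem_Ioc, Set.mem_Iio, Set.mem_Ioo]
    exact ⟨fun h => ⟨h.1.1, h.2⟩, fun h => ⟨⟨h.1, h.2.le.trans hxb⟩, h.2⟩⟩
  rw [intervalIntegral.integral_of_le (hx.trans hxb),
    MeasureTheory.setIntegral_indicator measurableSet_Iio, h]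
  simp [hx, mul_comm]

/-- Layer-cake formula for the expected distortion. -/
lemma integral_jointPr_lt_distortion {S X Y Sh : Type*} [Fintype S] [Fintype Y]
    (p : PMF S) (W : X → PMF Y) (e : S → X) (g : Y → Sh) (d : S → Sh → ℝ)
    (hd : ∀ s sh, 0 ≤ d s sh) {b : ℝ} (hb : ∀ s y, d s (g y) ≤ b) :
    ∫ α in (0 : ℝ)..b, jointPr p W e {sy | α < d sy.1 (g sy.2)} = jointExp p W e g d := by
  have hintegrable (s : S) (y : Y) : IntervalIntegrable
      ((Set.Iio (d s (g y))).indicator fun _ => (p s * W (e s) y).toReal)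
      MeasureTheory.volume 0 b := by
    rw [intervalIntegrable_iff]
    exact (MeasureTheory.integrableOn_const (by simp)).indicator measurableSet_Iio
  have heq (α : ℝ) : jointPr p W e {sy | α < d sy.1 (g sy.2)} =
      ∑ s, ∑ y, (Set.Iio (d s (g y))).indicator (fun _ => (p s * W (e s) y).toReal) α := rfl
  simp only [heq]
  rw [intervalIntegral.integral_finsetSum
    fun s _ => by simpa only [Finset.sum_fn] using
      IntervalIntegrable.sum _ fun y _ => hintegrable s y]
  refine Finset.sum_congr rfl fun s _ => ?_
  rw [intervalIntegral.integral_finsetSum fun y _ => hintegrable s y]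
  exact Finset.sum_congr rfl fun y _ => integral_indicator_Iio_const _ (hd s (g y)) (hb s y)

/-- General lower bound on the average JSCC distortion:
`E[d(S,g(Y))] ≥ ∫₀^{dmax} P(i(S,Y) ≤ R(α) − γ) dα − dmax·2^{−n(γ+k)} − dmax·P(S ∉ A)`. -/
theorem jscc_average_distortion_lower_bound
    {S X Y Sh : Type*} [Fintype S] [Nonempty S] [Fintype X] [Nonempty X]
    [Fintype Y] [Nonempty Y] [Fintype Sh] [Nonempty Sh]
    (n : ℕ) (hn : 1 ≤ n)
    (p : PMF S) (W : X → PMF Y) (e : S → X) (g : Y → Sh)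
    (d : S → Sh → ℝ) (hd : ∀ s sh, 0 ≤ d s sh)
    (A : Set S) (dmax : ℝ) (hdmax : 0 < dmax) (γ k : ℝ)
    (R : ℝ → ℝ) (hR : Antitone R)
    (hbound : ∀ s y, d s (g y) ≤ dmax)
    (hSPO : ∀ α : ℝ, 0 ≤ α → α ≤ dmax → ∀ sh : Sh,
      srcPr p {s | s ∈ A ∧ d s sh ≤ α} ≤ 2 ^ (-(n : ℝ) * (R α + k))) :
    jointExp p W e g d ≥
      (∫ α in (0:ℝ)..dmax,
        jointPr p W e {sy | infoDensity n p W e sy.1 sy.2 ≤ R α - γ})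
      - dmax * 2 ^ (-(n : ℝ) * (γ + k)) - dmax * srcPr p Aᶜ := by
  have hpt (α : ℝ) (hα : α ∈ Set.Icc 0 dmax) :
      jointPr p W e {sy | infoDensity n p W e sy.1 sy.2 ≤ R α - γ} ≤
        jointPr p W e {sy | α < d sy.1 (g sy.2)} +
          (srcPr p Aᶜ + 2 ^ (-(n : ℝ) * (γ + k))) := by
    have hsub : {sy : S × Y | infoDensity n p W e sy.1 sy.2 ≤ R α - γ} ⊆
        {sy | α < d sy.1 (g sy.2)} ∪ ({sy | sy.1 ∈ Aᶜ} ∪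
          ({sy | infoDensity n p W e sy.1 sy.2 ≤ R α - γ} ∩
            {sy | sy.1 ∈ {s | s ∈ A ∧ d s (g sy.2) ≤ α}})) := by
      intro sy hsy
      by_cases h₁ : α < d sy.1 (g sy.2)
      · exact Or.inl h₁
      by_cases h₂ : sy.1 ∈ A
      · exact Or.inr (Or.inr ⟨hsy, h₂, not_lt.mp h₁⟩)
      · exact Or.inr (Or.inl h₂)
    have hexp : (2 : ℝ) ^ ((n : ℝ) * (R α - γ)) * 2 ^ (-(n : ℝ) * (R α + k)) =
        2 ^ (-(n : ℝ) * (γ + k)) := by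
      rw [← Real.rpow_add two_pos]
      ring_nf
    have hlast := jointPr_infoDensity_le_inter hn p W e
      (fun y => {s | s ∈ A ∧ d s (g y) ≤ α}) (t := R α - γ)
      (fun y => hSPO α hα.1 hα.2 (g y))
    rw [hexp] at hlast
    refine (jointPr_mono p W e hsub).trans ((jointPr_union_le p W e _ _).trans ?_)
    gcongr
    refine (jointPr_union_le p W e _ _).trans ?_
    rw [jointPr_fst]
    gcongr
  have hanti₁ : Antitone fun α =>
      jointPr p W e {sy | infoDensity n p W e sy.1 sy.2 ≤ R α - γ} := fun a b hab =>
    jointPr_mono p W e fun _ h => le_trans h (sub_le_sub_right (hR hab) γ)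
  have hanti₂ : Antitone fun α => jointPr p W e {sy | α < d sy.1 (g sy.2)} := fun a b hab =>
    jointPr_mono p W e fun _ h => lt_of_le_of_lt hab h
  have hmain := intervalIntegral.integral_mono_on (μ := MeasureTheory.volume) hdmax.le
    hanti₁.intervalIntegrable
    (hanti₂.intervalIntegrable.add intervalIntegrable_const) hpt
  rw [intervalIntegral.integral_add hanti₂.intervalIntegrable intervalIntegrable_const,
    integral_jointPr_lt_distortion p W e g d hd hbound, intervalIntegral.integral_const,
    smul_eq_mul, sub_zero, mul_add] at hmain
  linarith
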